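/- Let m ≥ n ≥ 1 and let A, Â ∈ ℂ^{m×n} be column-orthonormal matrices. Then ( Σ_{S ⊆ [m], |S| = n} |det(Â_S) − det(A_S)|² )^{1/2} ≤ n · ‖Â − A‖₂. -/

import Mathlib

open Matrix
open scoped Matrix.Norms.L2Operator

/-- The `n × n` submatrix of an `m × n` matrix consisting of the rows indexed by
a subset `S ⊆ [m]` with `|S| = n`. -/
noncomputable def rowSubmatrix {m n : ℕ} (A : Matrix (Fin m) (Fin n) ℂ)
    (S : Finset (Fin m)) (hS : S.card = n) : Matrix (Fin n) (Fin n) ℂ :=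
  A.submatrix (fun i => ((S.orderIsoOfFin hS i : {x // x ∈ S}) : Fin m)) id

/-- Every injection `Fin n → Fin m` factors uniquely as a permutation of `Fin n` followed by the
increasing enumeration of a subset of size `n`. -/
lemma sum_eq_sum_subset_perm {R : Type*} [AddCommMonoid R] {m n : ℕ} (g : (Fin n → Fin m) → R)
    (hg : ∀ f, ¬ Function.Injective f → g f = 0) :
    ∑ f, g f = ∑ S : {S : Finset (Fin m) // S.card = n}, ∑ σ : Equiv.Perm (Fin n),
      g (S.1.orderEmbOfFin S.2 ∘ σ) := by
  rw [← Fintype.sum_prod_type']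
  symm
  refine Fintype.sum_of_injective
    (fun p : {S : Finset (Fin m) // S.card = n} × Equiv.Perm (Fin n) =>
      (p.1.1.orderEmbOfFin p.1.2 ∘ p.2 : Fin n → Fin m)) ?_ _ _ ?_ (fun _ => rfl)
  · rintro ⟨⟨S, hS⟩, σ⟩ ⟨⟨T, hT⟩, τ⟩ h
    have hr := congrArg Set.range h
    simp only [EquivLike.range_comp, Finset.range_orderEmbOfFin, Finset.coe_inj] at hr
    subst hr
    refine Prod.ext rfl (Equiv.ext fun i => ?_)
    exact (S.orderEmbOfFin hS).injective (congrFun h i)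
  · intro f hf
    apply hg
    intro hinj
    apply hf
    have hS : (Finset.univ.image f).card = n := by
      rw [Finset.card_image_of_injective _ hinj, Finset.card_fin]
    let e := (Finset.univ.image f).orderIsoOfFin hS
    let s : Fin n → Fin n := fun i =>
      e.symm ⟨f i, Finset.mem_image_of_mem f (Finset.mem_univ i)⟩
    have hs : Function.Injective s := fun i j hij =>
      hinj (congrArg Subtype.val (e.symm.injective hij))
    refine ⟨⟨⟨_, hS⟩, Equiv.ofBijective s (Finite.injective_iff_bijective.mp hs)⟩, ?_⟩
    funext i
    simp [s, e, ← Finset.coe_orderIsoOfFin_apply]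

/-- The **Cauchy–Binet formula**. -/
theorem det_mul_eq_sum_subset {R : Type*} [CommRing R] {m n : ℕ}
    (M : Matrix (Fin n) (Fin m) R) (N : Matrix (Fin m) (Fin n) R) :
    (M * N).det = ∑ S : {S : Finset (Fin m) // S.card = n},
      (M.submatrix id (S.1.orderEmbOfFin S.2)).det *
        (N.submatrix (S.1.orderEmbOfFin S.2) id).det := by
  have expand : (M * N).det =
      ∑ f : Fin n → Fin m, (M.submatrix id f).det * ∏ i, N (f i) i := by
    simp only [det_apply', mul_apply, Finset.prod_univ_sum, Finset.mul_sum,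
      Fintype.piFinset_univ, Finset.sum_mul]
    rw [Finset.sum_comm]
    simp [Finset.prod_mul_distrib, mul_assoc]
  rw [expand, sum_eq_sum_subset_perm]
  · refine Finset.sum_congr rfl fun S _ => ?_
    rw [det_apply' (N.submatrix _ _), Finset.mul_sum]
    refine Finset.sum_congr rfl fun σ _ => ?_
    have h := det_permute' σ (M.submatrix id (S.1.orderEmbOfFin S.2))
    rw [submatrix_submatrix] at h
    simp only [Function.comp_id] at h
    rw [h]
    simp only [submatrix_apply, Function.comp_apply, id]
    ring
  · intro f hf
    obtain ⟨i, j, hfij, hij⟩ := Function.not_injective_iff.mp hf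
    rw [det_zero_of_column_eq hij fun k => by simp [hfij], zero_mul]

/-- The squared norm of the vector of maximal minors is the Gram determinant. -/
lemma sum_norm_sq_det_rowSubmatrix {m n : ℕ} (B : Matrix (Fin m) (Fin n) ℂ) :
    ((∑ S : {S : Finset (Fin m) // S.card = n}, ‖(rowSubmatrix B S.1 S.2).det‖ ^ 2 : ℝ) : ℂ) =
      (Bᴴ * B).det := by
  rw [det_mul_eq_sum_subset]
  push_cast
  refine Finset.sum_congr rfl fun S _ => ?_
  rw [← conjTranspose_submatrix, det_conjTranspose]
  exact (Complex.conj_mul' _).symm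

lemma prod_le_one_of_sum_le_card {ι : Type*} [Fintype ι] (z : ι → ℝ) (hz : ∀ i, 0 ≤ z i)
    (hsum : ∑ i, z i ≤ Fintype.card ι) : ∏ i, z i ≤ 1 :=
  calc ∏ i, z i ≤ ∏ i, Real.exp (z i - 1) :=
        Finset.prod_le_prod (fun i _ => hz i) fun i _ => by
          linarith [Real.add_one_le_exp (z i - 1)]
    _ = Real.exp (∑ i, z i - Fintype.card ι) := by simp [← Real.exp_sum]
    _ ≤ 1 := Real.exp_le_one_iff.mpr (by linarith)

open scoped ComplexOrder in
/-- **Hadamard's inequality** for the maximal minors of a matrix with columns in the unit ball. -/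
lemma sum_norm_sq_det_rowSubmatrix_le_one {m n : ℕ} (B : Matrix (Fin m) (Fin n) ℂ)
    (hB : ∀ j, ∑ i, ‖B i j‖ ^ 2 ≤ 1) :
    ∑ S : {S : Finset (Fin m) // S.card = n}, ‖(rowSubmatrix B S.1 S.2).det‖ ^ 2 ≤ 1 := by
  have hG : (Bᴴ * B).PosSemidef := posSemidef_conjTranspose_mul_self B
  have hdet := sum_norm_sq_det_rowSubmatrix B
  rw [hG.isHermitian.det_eq_prod_eigenvalues] at hdet
  have hdet' : ∑ S : {S : Finset (Fin m) // S.card = n}, ‖(rowSubmatrix B S.1 S.2).det‖ ^ 2 =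
      ∏ i, hG.isHermitian.eigenvalues i :=
    Complex.ofReal_injective (hdet.trans (by simp))
  rw [hdet']
  refine prod_le_one_of_sum_le_card _ hG.eigenvalues_nonneg ?_
  have htr : ((∑ j, ∑ i, ‖B i j‖ ^ 2 : ℝ) : ℂ) = (Bᴴ * B).trace := by
    simp [trace, mul_apply, Complex.conj_mul']
  rw [hG.isHermitian.trace_eq_sum_eigenvalues] at htr
  have htr' : ∑ j, ∑ i, ‖B i j‖ ^ 2 = ∑ i, hG.isHermitian.eigenvalues i :=
    Complex.ofReal_injective (htr.trans (by simp))
  rw [← htr']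
  exact (Finset.sum_le_sum fun j _ => hB j).trans (by simp)

lemma rowSubmatrix_updateCol {m n : ℕ} (B : Matrix (Fin m) (Fin n) ℂ) (k : Fin n)
    (v : Fin m → ℂ) (S : Finset (Fin m)) (hS : S.card = n) :
    rowSubmatrix (B.updateCol k v) S hS =
      (rowSubmatrix B S hS).updateCol k (v ∘ S.orderEmbOfFin hS) := by
  ext i j
  simp [rowSubmatrix, updateCol_apply]

/-- The vector of maximal minors of a matrix. -/
noncomputable def maximalMinors {m n : ℕ} (B : Matrix (Fin m) (Fin n) ℂ) :
    EuclideanSpace ℂ {S : Finset (Fin m) // S.card = n} :=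
  WithLp.toLp 2 fun S => (rowSubmatrix B S.1 S.2).det

lemma maximalMinors_updateCol_sub {m n : ℕ} (B : Matrix (Fin m) (Fin n) ℂ) (k : Fin n)
    (u v : Fin m → ℂ) :
    maximalMinors (B.updateCol k (u - v)) =
      maximalMinors (B.updateCol k u) - maximalMinors (B.updateCol k v) := by
  rw [eq_sub_iff_add_eq]
  ext S
  simp only [maximalMinors, PiLp.add_apply, rowSubmatrix_updateCol]
  rw [← det_updateCol_add]
  congr 2
  ext i
  simp

lemma maximalMinors_updateCol_smul {m n : ℕ} (B : Matrix (Fin m) (Fin n) ℂ) (k : Fin n)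
    (c : ℂ) (v : Fin m → ℂ) :
    maximalMinors (B.updateCol k (c • v)) = c • maximalMinors (B.updateCol k v) := by
  ext S
  simp only [maximalMinors, PiLp.smul_apply, rowSubmatrix_updateCol, smul_eq_mul]
  rw [← det_updateCol_smul]
  rfl

lemma norm_maximalMinors_le_one {m n : ℕ} (B : Matrix (Fin m) (Fin n) ℂ)
    (hB : ∀ j, ‖WithLp.toLp 2 (B.col j)‖ ≤ 1) : ‖maximalMinors B‖ ≤ 1 := by
  rw [← sq_le_one_iff₀ (norm_nonneg _), EuclideanSpace.norm_sq_eq]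
  refine sum_norm_sq_det_rowSubmatrix_le_one B fun j => ?_
  have h := (sq_le_one_iff₀ (norm_nonneg _)).mpr (hB j)
  rwa [EuclideanSpace.norm_sq_eq] at h

lemma norm_maximalMinors_updateCol_le {m n : ℕ} (B : Matrix (Fin m) (Fin n) ℂ)
    (hB : ∀ j, ‖WithLp.toLp 2 (B.col j)‖ ≤ 1) (k : Fin n) (v : Fin m → ℂ) :
    ‖maximalMinors (B.updateCol k v)‖ ≤ ‖WithLp.toLp 2 v‖ := by
  set r : ℝ := ‖WithLp.toLp 2 v‖ with hr
  have hv : v = (r : ℂ) • ((r : ℂ)⁻¹ • v) := by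
    by_cases h : r = 0
    · have : v = 0 := by simpa [hr] using h
      simp [this]
    · rw [smul_inv_smul₀ (by exact_mod_cast h)]
  rw [hv, maximalMinors_updateCol_smul, norm_smul, Complex.norm_real, Real.norm_of_nonneg
    (norm_nonneg _)]
  refine mul_le_of_le_one_right (norm_nonneg _) (norm_maximalMinors_le_one _ fun j => ?_)
  by_cases hj : j = k
  · subst hj
    have : (B.updateCol j ((r : ℂ)⁻¹ • v)).col j = (r : ℂ)⁻¹ • v := by
      ext i; simp
    rw [this, WithLp.toLp_smul, norm_smul, norm_inv, Complex.norm_real,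
      Real.norm_of_nonneg (norm_nonneg _)]
    exact inv_mul_le_one
  · have : (B.updateCol k ((r : ℂ)⁻¹ • v)).col j = B.col j := by
      ext i; simp [hj]
    rw [this]
    exact hB j

lemma norm_col_le_l2_opNorm {m n : ℕ} (B : Matrix (Fin m) (Fin n) ℂ) (j : Fin n) :
    ‖WithLp.toLp 2 (B.col j)‖ ≤ ‖B‖ := by
  simpa using l2_opNorm_mulVec B (EuclideanSpace.single j 1)

lemma norm_col_eq_one_of_conjTranspose_mul_self {m n : ℕ} {B : Matrix (Fin m) (Fin n) ℂ}
    (hB : Bᴴ * B = 1) (j : Fin n) : ‖WithLp.toLp 2 (B.col j)‖ = 1 := by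
  have h := congrFun (congrFun hB j) j
  simp only [mul_apply, conjTranspose_apply, RCLike.star_def, Complex.conj_mul',
    one_apply_eq] at h
  rw [EuclideanSpace.norm_eq, Real.sqrt_eq_one]
  exact_mod_cast h

theorem stmt3 (m n : ℕ) (hn : 1 ≤ n) (hmn : n ≤ m)
    (A Ahat : Matrix (Fin m) (Fin n) ℂ)
    (hA : Aᴴ * A = 1) (hAhat : Ahatᴴ * Ahat = 1) :
    Real.sqrt (∑ S : {S : Finset (Fin m) // S.card = n},
        ‖(rowSubmatrix Ahat S.1 S.2).det - (rowSubmatrix A S.1 S.2).det‖ ^ 2)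
      ≤ n * ‖Ahat - A‖ := by
  have hnorm : Real.sqrt (∑ S : {S : Finset (Fin m) // S.card = n},
        ‖(rowSubmatrix Ahat S.1 S.2).det - (rowSubmatrix A S.1 S.2).det‖ ^ 2) =
      ‖maximalMinors Ahat - maximalMinors A‖ := by
    rw [EuclideanSpace.norm_eq]
    rfl
  rw [hnorm]
  -- `H k` has its first `k` columns from `Ahat` and the others from `A`.
  let H : ℕ → Matrix (Fin m) (Fin n) ℂ := fun k =>
    Matrix.of fun i j => if (j : ℕ) < k then Ahat i j else A i j
  have H_zero : H 0 = A := by ext i j; simp [H]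
  have H_n : H n = Ahat := by ext i j; simp [H]
  have H_col : ∀ k j, ‖WithLp.toLp 2 ((H k).col j)‖ ≤ 1 := by
    intro k j
    by_cases h : (j : ℕ) < k
    · have : (H k).col j = Ahat.col j := by ext i; simp [H, h]
      rw [this, norm_col_eq_one_of_conjTranspose_mul_self hAhat]
    · have : (H k).col j = A.col j := by ext i; simp [H, h]
      rw [this, norm_col_eq_one_of_conjTranspose_mul_self hA]
  have step : ∀ k ∈ Finset.range n,
      ‖maximalMinors (H (k + 1)) - maximalMinors (H k)‖ ≤ ‖Ahat - A‖ := by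
    intro k hk
    let j : Fin n := ⟨k, Finset.mem_range.mp hk⟩
    have h_succ : H (k + 1) = (H k).updateCol j (Ahat.col j) := by
      ext i l
      by_cases hl : l = j
      · simp [H, hl, j]
      · have hl' : (l : ℕ) ≠ k := fun h => hl (Fin.ext h)
        have : (l : ℕ) < k + 1 ↔ (l : ℕ) < k := by lia
        simp [H, hl, this]
    have h_self : H k = (H k).updateCol j (A.col j) := by
      ext i l
      by_cases hl : l = j
      · simp [H, hl, j]
      · simp [hl]
    calc ‖maximalMinors (H (k + 1)) - maximalMinors (H k)‖
        = ‖maximalMinors ((H k).updateCol j (Ahat.col j - A.col j))‖ := by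
          rw [maximalMinors_updateCol_sub, ← h_succ, ← h_self]
      _ ≤ ‖WithLp.toLp 2 (Ahat.col j - A.col j)‖ :=
          norm_maximalMinors_updateCol_le _ (H_col k) _ _
      _ ≤ ‖Ahat - A‖ := norm_col_le_l2_opNorm (Ahat - A) j
  calc ‖maximalMinors Ahat - maximalMinors A‖
      = ‖∑ k ∈ Finset.range n, (maximalMinors (H (k + 1)) - maximalMinors (H k))‖ := by
        rw [Finset.sum_range_sub (fun k => maximalMinors (H k)), H_zero, H_n]
    _ ≤ ∑ _k ∈ Finset.range n, ‖Ahat - A‖ := norm_sum_le_of_le _ step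
    _ = n * ‖Ahat - A‖ := by simp
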